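/- arXiv:math/0605704 — 3 statements merged into one kernel-verified Lean document; each statement's English description precedes it below -/
import Mathlib

section
/- The Moyal product makes R[h] into an associative unital algebra over k[h]: for all f, g, p ∈ R[h] one has (f *_h g) *_h p = f *_h (g *_h p), the product is k[h]-bilinear, and 1 *_h f = f = f *_h 1. -/
open scoped TensorProduct

noncomputable section

/-- `R k n` is the polynomial ring `k[x_1,…,x_n,y_1,…,y_n]`, with the `x` variables
indexed by `Sum.inl` and the `y` variables indexed by `Sum.inr`. -/
abbrev MoyalR (k : Type) [Field k] (n : ℕ) : Type := MvPolynomial (Fin n ⊕ Fin n) k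

/-- The bivector operator `π = Σ_i (∂/∂x_i ⊗ ∂/∂y_i − ∂/∂y_i ⊗ ∂/∂x_i)`
acting on `R ⊗[k] R`. -/
def moyalPi (k : Type) [Field k] (n : ℕ) :
    MoyalR k n ⊗[k] MoyalR k n →ₗ[k] MoyalR k n ⊗[k] MoyalR k n :=
  ∑ i : Fin n,
    (TensorProduct.map (MvPolynomial.pderiv (Sum.inl i)).toLinearMap
        (MvPolynomial.pderiv (Sum.inr i)).toLinearMap
      - TensorProduct.map (MvPolynomial.pderiv (Sum.inr i)).toLinearMap
        (MvPolynomial.pderiv (Sum.inl i)).toLinearMap)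

/-- The Moyal product of two elements of `R`, landing in `R[h]` (with `h = Polynomial.X`):
`f *_h g = Σ_{d≥0} (h^d/(2^d d!)) · m(π^d(f ⊗ g))`.  The sum is truncated at
`totalDegree f + totalDegree g`, beyond which all terms vanish. -/
def moyalAux {k : Type} [Field k] {n : ℕ} (f g : MoyalR k n) : Polynomial (MoyalR k n) :=
  ∑ d ∈ Finset.range (f.totalDegree + g.totalDegree + 1),
    Polynomial.C (((2 ^ d * d.factorial : k)⁻¹) •
        LinearMap.mul' k (MoyalR k n) (((moyalPi k n) ^ d) (f ⊗ₜ[k] g))) *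
      Polynomial.X ^ d

/-- The `k[h]`-bilinear extension of the Moyal product to `R[h] = Polynomial R`. -/
def moyal {k : Type} [Field k] {n : ℕ} (F G : Polynomial (MoyalR k n)) :
    Polynomial (MoyalR k n) :=
  ∑ i ∈ F.support, ∑ j ∈ G.support,
    Polynomial.X ^ (i + j) * moyalAux (F.coeff i) (G.coeff j)

namespace Moyal

open Polynomial

section Bracket

variable {ι E : Type*} [Fintype ι] [Ring E]

/-- The standard symplectic pairing `∑ i, (u xᵢ * v yᵢ - u yᵢ * v xᵢ)` of two families of
ring elements. -/
def bracket (u v : ι ⊕ ι → E) : E :=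
  ∑ i, (u (Sum.inl i) * v (Sum.inr i) - u (Sum.inr i) * v (Sum.inl i))

lemma bracket_add_left (u u' v : ι ⊕ ι → E) :
    bracket (u + u') v = bracket u v + bracket u' v := by
  simp only [bracket, ← Finset.sum_add_distrib, Pi.add_apply]
  exact Finset.sum_congr rfl fun i _ => by noncomm_ring

lemma bracket_add_right (u v v' : ι ⊕ ι → E) :
    bracket u (v + v') = bracket u v + bracket u v' := by
  simp only [bracket, ← Finset.sum_add_distrib, Pi.add_apply]
  exact Finset.sum_congr rfl fun i _ => by noncomm_ring

lemma commute_bracket_right {a : E} {u v : ι ⊕ ι → E}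
    (hu : ∀ s, Commute a (u s)) (hv : ∀ s, Commute a (v s)) : Commute a (bracket u v) :=
  Commute.sum_right _ _ _ fun _ _ =>
    ((hu _).mul_right (hv _)).sub_right ((hu _).mul_right (hv _))

lemma commute_bracket {u v u' v' : ι ⊕ ι → E}
    (huu : ∀ s t, Commute (u s) (u' t)) (huv : ∀ s t, Commute (u s) (v' t))
    (hvu : ∀ s t, Commute (v s) (u' t)) (hvv : ∀ s t, Commute (v s) (v' t)) :
    Commute (bracket u v) (bracket u' v') :=
  (commute_bracket_right
    (fun t => (commute_bracket_right (fun s => (huu s t).symm) fun s => (hvu s t).symm).symm)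
    (fun t => (commute_bracket_right (fun s => (huv s t).symm) fun s => (hvv s t).symm).symm))

variable {k M N : Type*} [Field k] [AddCommGroup M] [Module k M] [AddCommGroup N] [Module k N]

/-- A linear map intertwining two pairs of families intertwines the powers of their brackets. -/
lemma bracket_pow_apply_of_intertwine {u v : ι ⊕ ι → Module.End k M}
    {u' v' : ι ⊕ ι → Module.End k N} {φ : M →ₗ[k] N}
    (hu : ∀ s, u' s ∘ₗ φ = φ ∘ₗ u s) (hv : ∀ s, v' s ∘ₗ φ = φ ∘ₗ v s) (d : ℕ) (m : M) :
    (bracket u' v' ^ d) (φ m) = φ ((bracket u v ^ d) m) := by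
  have hu' : ∀ s m, u' s (φ m) = φ (u s m) := fun s => LinearMap.congr_fun (hu s)
  have hv' : ∀ s m, v' s (φ m) = φ (v s m) := fun s => LinearMap.congr_fun (hv s)
  have h : bracket u' v' ∘ₗ φ = φ ∘ₗ bracket u v := by
    ext m
    simp [bracket, hu', hv']
  exact LinearMap.congr_fun (Module.End.commute_pow_left_of_commute h d) m

end Bracket

section Poisson

variable {k ι V : Type*} [Field k] [CommRing V] [Algebra k V]
  (D : ι ⊕ ι → Derivation k V V)

/-- The partial derivative in the first tensor factor. -/
def partialFst (s : ι ⊕ ι) : Module.End k ((V ⊗[k] V) ⊗[k] V) :=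
  ((D s).toLinearMap.rTensor _).rTensor _

/-- The partial derivative in the second tensor factor. -/
def partialSnd (s : ι ⊕ ι) : Module.End k ((V ⊗[k] V) ⊗[k] V) :=
  ((D s).toLinearMap.lTensor _).rTensor _

/-- The partial derivative in the third tensor factor. -/
def partialTrd (s : ι ⊕ ι) : Module.End k ((V ⊗[k] V) ⊗[k] V) :=
  (D s).toLinearMap.lTensor _

lemma partialFst_commute_partialSnd (s t : ι ⊕ ι) :
    Commute (partialFst D s : Module.End k ((V ⊗[k] V) ⊗[k] V)) (partialSnd D t) := by
  refine TensorProduct.ext_threefold fun f g p => ?_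
  simp [partialFst, partialSnd]

lemma partialFst_commute_partialTrd (s t : ι ⊕ ι) :
    Commute (partialFst D s : Module.End k ((V ⊗[k] V) ⊗[k] V)) (partialTrd D t) := by
  refine TensorProduct.ext_threefold fun f g p => ?_
  simp [partialFst, partialTrd]

lemma partialSnd_commute_partialTrd (s t : ι ⊕ ι) :
    Commute (partialSnd D s : Module.End k ((V ⊗[k] V) ⊗[k] V)) (partialTrd D t) := by
  refine TensorProduct.ext_threefold fun f g p => ?_
  simp [partialSnd, partialTrd]

lemma partialFst_commute {D : ι ⊕ ι → Derivation k V V}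
    (hD : ∀ s t v, D s (D t v) = D t (D s v)) (s t : ι ⊕ ι) :
    Commute (partialFst D s : Module.End k ((V ⊗[k] V) ⊗[k] V)) (partialFst D t) := by
  refine TensorProduct.ext_threefold fun f g p => ?_
  simp [partialFst, hD s t]

lemma partialSnd_commute {D : ι ⊕ ι → Derivation k V V}
    (hD : ∀ s t v, D s (D t v) = D t (D s v)) (s t : ι ⊕ ι) :
    Commute (partialSnd D s : Module.End k ((V ⊗[k] V) ⊗[k] V)) (partialSnd D t) := by
  refine TensorProduct.ext_threefold fun f g p => ?_
  simp [partialSnd, hD s t]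

lemma partialTrd_commute {D : ι ⊕ ι → Derivation k V V}
    (hD : ∀ s t v, D s (D t v) = D t (D s v)) (s t : ι ⊕ ι) :
    Commute (partialTrd D s : Module.End k ((V ⊗[k] V) ⊗[k] V)) (partialTrd D t) := by
  refine TensorProduct.ext_threefold fun f g p => ?_
  simp [partialTrd, hD s t]

variable [Fintype ι]

/-- The bivector operator on `V ⊗ V` attached to a family of derivations of `V`. -/
def poisson : Module.End k (V ⊗[k] V) :=
  bracket (fun s => (D s).toLinearMap.rTensor V) (fun s => (D s).toLinearMap.lTensor V)

/-- The coefficient of `h ^ d` in the star product, as a linear map on `V ⊗ V`. -/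
def poissonTerm (d : ℕ) : V ⊗[k] V →ₗ[k] V :=
  ((2 ^ d * d.factorial : k)⁻¹) • LinearMap.mul' k V ∘ₗ (poisson D ^ d)

/-- The operator `poisson D` acting on the first two tensor factors. -/
def piFstSnd : Module.End k ((V ⊗[k] V) ⊗[k] V) := bracket (partialFst D) (partialSnd D)

/-- The operator `poisson D` acting on the outer two tensor factors. -/
def piFstTrd : Module.End k ((V ⊗[k] V) ⊗[k] V) := bracket (partialFst D) (partialTrd D)

/-- The operator `poisson D` acting on the last two tensor factors. -/
def piSndTrd : Module.End k ((V ⊗[k] V) ⊗[k] V) := bracket (partialSnd D) (partialTrd D)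

variable (k V) in
/-- Multiplication of the first two tensor factors. -/
def mulFstSnd : (V ⊗[k] V) ⊗[k] V →ₗ[k] V ⊗[k] V :=
  (LinearMap.mul' k V).rTensor _

variable (k V) in
/-- Multiplication of the last two tensor factors. -/
def mulSndTrd : (V ⊗[k] V) ⊗[k] V →ₗ[k] V ⊗[k] V :=
  (LinearMap.mul' k V).lTensor _ ∘ₗ (TensorProduct.assoc k _ _ _).toLinearMap

variable (k V) in
/-- Multiplication of all three tensor factors. -/
def mulTriple : (V ⊗[k] V) ⊗[k] V →ₗ[k] V := LinearMap.mul' k V ∘ₗ mulFstSnd k V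

variable (k V) in
lemma mulTriple_eq : mulTriple k V = LinearMap.mul' k V ∘ₗ mulSndTrd k V := by
  refine TensorProduct.ext_threefold fun f g p => ?_
  simp [mulTriple, mulFstSnd, mulSndTrd, mul_assoc]

variable {D}

lemma commute_left (hD : ∀ s t v, D s (D t v) = D t (D s v)) :
    Commute (piFstTrd D + piSndTrd D) (piFstSnd D) :=
  (commute_bracket (partialFst_commute hD) (partialFst_commute_partialSnd D)
      (fun s t => (partialFst_commute_partialTrd D t s).symm)
      (fun s t => (partialSnd_commute_partialTrd D t s).symm)).add_left
    (commute_bracket (fun s t => (partialFst_commute_partialSnd D t s).symm)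
      (partialSnd_commute hD) (fun s t => (partialFst_commute_partialTrd D t s).symm)
      (fun s t => (partialSnd_commute_partialTrd D t s).symm))

lemma commute_right (hD : ∀ s t v, D s (D t v) = D t (D s v)) :
    Commute (piFstSnd D + piFstTrd D) (piSndTrd D) :=
  (commute_bracket (partialFst_commute_partialSnd D) (partialFst_commute_partialTrd D)
      (partialSnd_commute hD) (partialSnd_commute_partialTrd D)).add_left
    (commute_bracket (partialFst_commute_partialSnd D) (partialFst_commute_partialTrd D)
      (fun s t => (partialSnd_commute_partialTrd D t s).symm) (partialTrd_commute hD))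

variable (D)

lemma poisson_pow_mulFstSnd (d : ℕ) (t : (V ⊗[k] V) ⊗[k] V) :
    (poisson D ^ d) (mulFstSnd k V t) =
      mulFstSnd k V (((piFstTrd D + piSndTrd D) ^ d) t) := by
  rw [poisson, piFstTrd, piSndTrd, ← bracket_add_left]
  refine bracket_pow_apply_of_intertwine (fun s => ?_) (fun s => ?_) d t
  all_goals
    refine TensorProduct.ext_threefold fun f g p => ?_
    simp [mulFstSnd, partialFst, partialSnd, partialTrd, mul_comm, add_comm, TensorProduct.add_tmul]

lemma poisson_pow_mulSndTrd (d : ℕ) (t : (V ⊗[k] V) ⊗[k] V) :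
    (poisson D ^ d) (mulSndTrd k V t) =
      mulSndTrd k V (((piFstSnd D + piFstTrd D) ^ d) t) := by
  rw [poisson, piFstSnd, piFstTrd, ← bracket_add_right]
  refine bracket_pow_apply_of_intertwine (fun s => ?_) (fun s => ?_) d t
  all_goals
    refine TensorProduct.ext_threefold fun f g p => ?_
    simp [mulSndTrd, partialFst, partialSnd, partialTrd, mul_comm, add_comm, TensorProduct.tmul_add]

lemma piFstSnd_pow_tmul (d : ℕ) (t : V ⊗[k] V) (p : V) :
    (piFstSnd D ^ d) (t ⊗ₜ p) = ((poisson D ^ d) t) ⊗ₜ p := by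
  rw [poisson]
  exact bracket_pow_apply_of_intertwine (ι := ι)
    (φ := (TensorProduct.mk k (V ⊗[k] V) V).flip p)
    (fun s => rfl) (fun s => rfl) d t

lemma piSndTrd_pow_assoc_symm (d : ℕ) (f : V) (t : V ⊗[k] V) :
    (piSndTrd D ^ d) ((TensorProduct.assoc k _ _ _).symm (f ⊗ₜ t)) =
      (TensorProduct.assoc k _ _ _).symm (f ⊗ₜ ((poisson D ^ d) t)) := by
  rw [poisson]
  refine bracket_pow_apply_of_intertwine (ι := ι)
    (φ := (TensorProduct.assoc k _ _ _).symm.toLinearMap ∘ₗ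
      TensorProduct.mk k V (V ⊗[k] V) f)
    (fun s => ?_) (fun s => ?_) d t
  all_goals
    refine TensorProduct.ext' fun g p => ?_
    simp [partialSnd, partialTrd]

lemma poissonTerm_poissonTerm_left (a b : ℕ) (f g p : V) :
    poissonTerm D a (poissonTerm D b (f ⊗ₜ g) ⊗ₜ p) =
      ((2 ^ a * a.factorial : k)⁻¹ * (2 ^ b * b.factorial : k)⁻¹) • mulTriple k V
        (((piFstTrd D + piSndTrd D) ^ a * piFstSnd D ^ b) ((f ⊗ₜ g) ⊗ₜ p)) := by
  rw [Module.End.mul_apply, piFstSnd_pow_tmul, mulTriple, LinearMap.comp_apply,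
    ← poisson_pow_mulFstSnd]
  simp [poissonTerm, mulFstSnd, ← TensorProduct.smul_tmul', smul_smul, mul_comm]

lemma poissonTerm_poissonTerm_right (a b : ℕ) (f g p : V) :
    poissonTerm D a (f ⊗ₜ poissonTerm D b (g ⊗ₜ p)) =
      ((2 ^ a * a.factorial : k)⁻¹ * (2 ^ b * b.factorial : k)⁻¹) • mulTriple k V
        (((piFstSnd D + piFstTrd D) ^ a * piSndTrd D ^ b) ((f ⊗ₜ g) ⊗ₜ p)) := by
  rw [Module.End.mul_apply, ← TensorProduct.assoc_symm_tmul, piSndTrd_pow_assoc_symm,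
    mulTriple_eq, LinearMap.comp_apply, ← poisson_pow_mulSndTrd]
  simp [poissonTerm, mulSndTrd, smul_smul, mul_comm]

lemma sum_antidiagonal_smul_pow [CharZero k] {M N : Type*} [AddCommGroup M] [Module k M]
    [AddCommGroup N] [Module k N] {A B : Module.End k M} (h : Commute A B) (φ : M →ₗ[k] N)
    (d : ℕ) (t : M) :
    ∑ a ∈ Finset.HasAntidiagonal.antidiagonal d,
      ((2 ^ a.2 * a.2.factorial : k)⁻¹ * (2 ^ a.1 * a.1.factorial : k)⁻¹) •
        φ ((A ^ a.2 * B ^ a.1) t) =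
      (2 ^ d * d.factorial : k)⁻¹ • φ (((A + B) ^ d) t) := by
  rw [add_comm A B, h.symm.add_pow', LinearMap.sum_apply, map_sum, Finset.smul_sum]
  refine Finset.sum_congr rfl fun a ha => ?_
  obtain rfl := Finset.HasAntidiagonal.mem_antidiagonal.1 ha
  rw [(h.pow_pow _ _).eq, LinearMap.smul_apply, map_nsmul, ← Nat.cast_smul_eq_nsmul k, smul_smul,
    Nat.cast_add_choose]
  congr 1
  have h₁ : (a.1.factorial : k) ≠ 0 := Nat.cast_ne_zero.2 a.1.factorial_ne_zero
  have h₂ : (a.2.factorial : k) ≠ 0 := Nat.cast_ne_zero.2 a.2.factorial_ne_zero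
  have h₃ : ((a.1 + a.2).factorial : k) ≠ 0 := Nat.cast_ne_zero.2 (a.1 + a.2).factorial_ne_zero
  field_simp
  ring

variable {D} in
lemma sum_poissonTerm_poissonTerm [CharZero k] (hD : ∀ s t v, D s (D t v) = D t (D s v))
    (d : ℕ) (f g p : V) :
    ∑ a ∈ Finset.HasAntidiagonal.antidiagonal d,
      poissonTerm D a.2 (poissonTerm D a.1 (f ⊗ₜ g) ⊗ₜ p) =
    ∑ a ∈ Finset.HasAntidiagonal.antidiagonal d,
      poissonTerm D a.2 (f ⊗ₜ poissonTerm D a.1 (g ⊗ₜ p)) := by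
  simp only [poissonTerm_poissonTerm_left, poissonTerm_poissonTerm_right]
  rw [sum_antidiagonal_smul_pow (commute_left hD), sum_antidiagonal_smul_pow (commute_right hD),
    add_assoc (piFstSnd D), add_comm (piFstSnd D)]

end Poisson

variable {k : Type} [Field k] {n : ℕ}

/-- The partial derivative as a linear endomorphism. -/
def partialEnd (s : Fin n ⊕ Fin n) : Module.End k (MoyalR k n) :=
  (MvPolynomial.pderiv s).toLinearMap

lemma coeff_partialEnd (s : Fin n ⊕ Fin n) (f : MoyalR k n) (m : Fin n ⊕ Fin n →₀ ℕ) :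
    (partialEnd s f).coeff m = f.coeff (m + Finsupp.single s 1) * (m s + 1) :=
  MvPolynomial.coeff_pderiv f m

lemma partialEnd_commute (s t : Fin n ⊕ Fin n) :
    Commute (partialEnd s : Module.End k (MoyalR k n)) (partialEnd t) := by
  refine LinearMap.ext fun f => MvPolynomial.ext _ _ fun m => ?_
  rcases eq_or_ne s t with rfl | h
  · rfl
  · simp only [Module.End.mul_apply, coeff_partialEnd, Finsupp.add_apply,
      Finsupp.single_eq_of_ne h, Finsupp.single_eq_of_ne h.symm, add_right_comm m]
    push_cast
    ring

lemma moyalPi_eq_poisson :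
    moyalPi k n = poisson (MvPolynomial.pderiv : Fin n ⊕ Fin n → _) := by
  refine Finset.sum_congr rfl fun i _ => ?_
  simp only [LinearMap.rTensor, LinearMap.lTensor, ← TensorProduct.map_mul]
  rfl

lemma moyalPi_tmul (f g : MoyalR k n) : moyalPi k n (f ⊗ₜ g) =
    ∑ i, (partialEnd (Sum.inl i) f ⊗ₜ partialEnd (Sum.inr i) g
      - partialEnd (Sum.inr i) f ⊗ₜ partialEnd (Sum.inl i) g) := by
  simp [moyalPi, partialEnd]

lemma moyalPi_pow_tmul_eq_zero (d : ℕ) (f g : MoyalR k n)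
    (hf : ∀ m, f.coeff m ≠ 0 → m.degree < d) : (moyalPi k n ^ d) (f ⊗ₜ g) = 0 := by
  induction d generalizing f g with
  | zero =>
    have : f = 0 := MvPolynomial.ext _ _ fun m => by
      by_contra h
      exact absurd (hf m h) (Nat.not_lt_zero _)
    simp [this]
  | succ d ih =>
    have h (s : Fin n ⊕ Fin n) (g' : MoyalR k n) :
        (moyalPi k n ^ d) (partialEnd s f ⊗ₜ g') = 0 := by
      refine ih _ _ fun m hm => ?_
      rw [coeff_partialEnd] at hm
      simpa using hf _ (left_ne_zero_of_mul hm)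
    simp [pow_succ, moyalPi_tmul, h]

/-- The coefficient of `h ^ d` in the Moyal product, as a linear map on `R ⊗ R`. -/
def moyalTerm (k : Type) [Field k] (n d : ℕ) : MoyalR k n ⊗[k] MoyalR k n →ₗ[k] MoyalR k n :=
  ((2 ^ d * d.factorial : k)⁻¹) • LinearMap.mul' k (MoyalR k n) ∘ₗ (moyalPi k n ^ d)

lemma moyalTerm_eq_poissonTerm (d : ℕ) :
    moyalTerm k n d = poissonTerm (MvPolynomial.pderiv : Fin n ⊕ Fin n → _) d := by
  rw [moyalTerm, moyalPi_eq_poisson, poissonTerm]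

lemma moyalTerm_eq_zero {d : ℕ} {f : MoyalR k n} (hf : f.totalDegree < d) (g : MoyalR k n) :
    moyalTerm k n d (f ⊗ₜ g) = 0 := by
  have : (moyalPi k n ^ d) (f ⊗ₜ g) = 0 := moyalPi_pow_tmul_eq_zero d f g fun m hm =>
    (MvPolynomial.le_totalDegree (MvPolynomial.mem_support_iff.2 hm)).trans_lt hf
  simp [moyalTerm, this]

lemma coeff_moyalAux (f g : MoyalR k n) (d : ℕ) :
    (moyalAux f g).coeff d = moyalTerm k n d (f ⊗ₜ g) := by
  simp only [moyalAux, finsetSum_coeff, coeff_C_mul_X_pow]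
  rw [Finset.sum_ite_eq]
  split_ifs with h
  · rfl
  · exact (moyalTerm_eq_zero (by simp at h; omega) g).symm

lemma moyalAux_add_left (f f' g : MoyalR k n) :
    moyalAux (f + f') g = moyalAux f g + moyalAux f' g := by
  ext1 d
  simp [coeff_moyalAux, TensorProduct.add_tmul]

lemma moyalAux_add_right (f g g' : MoyalR k n) :
    moyalAux f (g + g') = moyalAux f g + moyalAux f g' := by
  ext1 d
  simp [coeff_moyalAux, TensorProduct.tmul_add]

lemma moyalAux_zero_left (g : MoyalR k n) : moyalAux 0 g = 0 := by
  ext1 d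
  simp [coeff_moyalAux]

lemma moyalAux_zero_right (f : MoyalR k n) : moyalAux f 0 = 0 := by
  ext1 d
  simp [coeff_moyalAux]

lemma moyalAux_C_mul_left (c : k) (f g : MoyalR k n) :
    moyalAux (MvPolynomial.C c * f) g = C (MvPolynomial.C c) * moyalAux f g := by
  ext1 d
  simp [coeff_moyalAux, MvPolynomial.C_mul', ← TensorProduct.smul_tmul']

lemma moyalAux_C_mul_right (c : k) (f g : MoyalR k n) :
    moyalAux f (MvPolynomial.C c * g) = C (MvPolynomial.C c) * moyalAux f g := by
  ext1 d
  simp [coeff_moyalAux, MvPolynomial.C_mul']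

lemma partialEnd_one (s : Fin n ⊕ Fin n) : partialEnd s (1 : MoyalR k n) = 0 := by
  simp [partialEnd]

lemma moyalAux_one_left (f : MoyalR k n) : moyalAux 1 f = C f := by
  ext1 d
  rw [coeff_moyalAux, coeff_C]
  cases d with
  | zero => simp [moyalTerm]
  | succ d => simp [moyalTerm, pow_succ, moyalPi_tmul, partialEnd_one]

lemma moyalAux_one_right (f : MoyalR k n) : moyalAux f 1 = C f := by
  ext1 d
  rw [coeff_moyalAux, coeff_C]
  cases d with
  | zero => simp [moyalTerm]
  | succ d => simp [moyalTerm, pow_succ, moyalPi_tmul, partialEnd_one]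

lemma moyal_eq_sum (F G : (MoyalR k n)[X]) :
    moyal F G = F.sum fun i f => G.sum fun j g => X ^ (i + j) * moyalAux f g :=
  rfl

lemma moyal_add_left (F G P : (MoyalR k n)[X]) : moyal (F + G) P = moyal F P + moyal G P := by
  simp only [moyal_eq_sum]
  refine sum_add_index _ _ _ (fun i => ?_) fun i f f' => ?_
  · simp [moyalAux_zero_left, Polynomial.sum]
  · simp [moyalAux_add_left, mul_add, Polynomial.sum, Finset.sum_add_distrib]

lemma moyal_add_right (F G P : (MoyalR k n)[X]) : moyal F (G + P) = moyal F G + moyal F P := by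
  simp only [moyal_eq_sum]
  rw [Polynomial.sum, Polynomial.sum, Polynomial.sum, ← Finset.sum_add_distrib]
  refine Finset.sum_congr rfl fun i _ => sum_add_index _ _ _ (fun j => ?_) fun j g g' => ?_
  · simp [moyalAux_zero_right]
  · simp [moyalAux_add_right, mul_add]

lemma moyal_monomial (i j : ℕ) (f g : MoyalR k n) :
    moyal (monomial i f) (monomial j g) = X ^ (i + j) * moyalAux f g := by
  rw [moyal_eq_sum, sum_monomial_index, sum_monomial_index]
  · simp [moyalAux_zero_right]
  · simp [moyalAux_zero_left, Polynomial.sum]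

lemma moyal_map_mul_left (a : k[X]) (F G : (MoyalR k n)[X]) :
    moyal (a.map (algebraMap k (MoyalR k n)) * F) G
      = a.map (algebraMap k (MoyalR k n)) * moyal F G := by
  induction a using Polynomial.induction_on' with
  | add a b ha hb => simp only [Polynomial.map_add, add_mul, moyal_add_left, ha, hb]
  | monomial l c =>
  induction F using Polynomial.induction_on' with
  | add a b ha hb => simp only [mul_add, moyal_add_left, ha, hb]
  | monomial i f =>
  induction G using Polynomial.induction_on' with
  | add a b ha hb => simp only [mul_add, moyal_add_right, ha, hb]
  | monomial j g =>
  rw [map_monomial, monomial_mul_monomial, moyal_monomial, moyal_monomial,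
    MvPolynomial.algebraMap_eq, moyalAux_C_mul_left, ← C_mul_X_pow_eq_monomial]
  ring

lemma moyal_map_mul_right (a : k[X]) (F G : (MoyalR k n)[X]) :
    moyal F (a.map (algebraMap k (MoyalR k n)) * G)
      = a.map (algebraMap k (MoyalR k n)) * moyal F G := by
  induction a using Polynomial.induction_on' with
  | add a b ha hb => simp only [Polynomial.map_add, add_mul, moyal_add_right, ha, hb]
  | monomial l c =>
  induction F using Polynomial.induction_on' with
  | add a b ha hb => simp only [mul_add, moyal_add_left, ha, hb]
  | monomial i f =>
  induction G using Polynomial.induction_on' with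
  | add a b ha hb => simp only [mul_add, moyal_add_right, ha, hb]
  | monomial j g =>
  rw [map_monomial, monomial_mul_monomial, moyal_monomial, moyal_monomial,
    MvPolynomial.algebraMap_eq, moyalAux_C_mul_right, ← C_mul_X_pow_eq_monomial]
  ring

lemma moyal_X_pow_mul_left (i : ℕ) (F G : (MoyalR k n)[X]) :
    moyal (X ^ i * F) G = X ^ i * moyal F G := by
  simpa using moyal_map_mul_left (X ^ i) F G

lemma moyal_X_pow_mul_right (i : ℕ) (F G : (MoyalR k n)[X]) :
    moyal F (X ^ i * G) = X ^ i * moyal F G := by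
  simpa using moyal_map_mul_right (X ^ i) F G

lemma moyal_C_C (f g : MoyalR k n) : moyal (C f) (C g) = moyalAux f g := by
  simpa using moyal_monomial 0 0 f g

lemma moyal_one_left (F : (MoyalR k n)[X]) : moyal 1 F = F := by
  induction F using Polynomial.induction_on' with
  | add a b ha hb => rw [moyal_add_right, ha, hb]
  | monomial i f =>
    rw [← C_mul_X_pow_eq_monomial, mul_comm, moyal_X_pow_mul_right, ← C_1, moyal_C_C,
      moyalAux_one_left]

lemma moyal_one_right (F : (MoyalR k n)[X]) : moyal F 1 = F := by
  induction F using Polynomial.induction_on' with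
  | add a b ha hb => rw [moyal_add_left, ha, hb]
  | monomial i f =>
    rw [← C_mul_X_pow_eq_monomial, mul_comm, moyal_X_pow_mul_left, ← C_1, moyal_C_C,
      moyalAux_one_right]

lemma coeff_moyal_C_right (F : (MoyalR k n)[X]) (p : MoyalR k n) (N : ℕ) :
    (moyal F (C p)).coeff N =
      ∑ a ∈ Finset.HasAntidiagonal.antidiagonal N, moyalTerm k n a.2 (F.coeff a.1 ⊗ₜ p) := by
  induction F using Polynomial.induction_on' with
  | add F G hF hG =>
    simp [moyal_add_left, hF, hG, TensorProduct.add_tmul, Finset.sum_add_distrib]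
  | monomial i f =>
    rw [← C_mul_X_pow_eq_monomial, mul_comm, moyal_X_pow_mul_left, moyal_C_C, coeff_mul]
    refine Finset.sum_congr rfl fun a _ => ?_
    rw [coeff_moyalAux, coeff_X_pow, coeff_X_pow_mul', coeff_C]
    split_ifs <;> first | omega | simp

lemma coeff_moyal_C_left (F : (MoyalR k n)[X]) (p : MoyalR k n) (N : ℕ) :
    (moyal (C p) F).coeff N =
      ∑ a ∈ Finset.HasAntidiagonal.antidiagonal N, moyalTerm k n a.2 (p ⊗ₜ F.coeff a.1) := by
  induction F using Polynomial.induction_on' with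
  | add F G hF hG =>
    simp [moyal_add_right, hF, hG, TensorProduct.tmul_add, Finset.sum_add_distrib]
  | monomial i f =>
    rw [← C_mul_X_pow_eq_monomial, mul_comm, moyal_X_pow_mul_right, moyal_C_C, coeff_mul]
    refine Finset.sum_congr rfl fun a _ => ?_
    rw [coeff_moyalAux, coeff_X_pow, coeff_X_pow_mul', coeff_C]
    split_ifs <;> first | omega | simp

lemma moyal_assoc_C [CharZero k] (f g p : MoyalR k n) :
    moyal (moyalAux f g) (C p) = moyal (C f) (moyalAux g p) := by
  ext1 d
  rw [coeff_moyal_C_right, coeff_moyal_C_left]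
  simp only [coeff_moyalAux, moyalTerm_eq_poissonTerm]
  exact sum_poissonTerm_poissonTerm
    (fun s t f => LinearMap.congr_fun (partialEnd_commute s t) f) d f g p

lemma moyal_assoc [CharZero k] (F G P : (MoyalR k n)[X]) :
    moyal (moyal F G) P = moyal F (moyal G P) := by
  induction F using Polynomial.induction_on' with
  | add a b ha hb => simp only [moyal_add_left, ha, hb]
  | monomial i f =>
  induction G using Polynomial.induction_on' with
  | add a b ha hb => simp only [moyal_add_left, moyal_add_right, ha, hb]
  | monomial j g =>
  induction P using Polynomial.induction_on' with
  | add a b ha hb => simp only [moyal_add_right, ha, hb]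
  | monomial l p =>
  simp only [← C_mul_X_pow_eq_monomial, mul_comm (C _), moyal_X_pow_mul_left,
    moyal_X_pow_mul_right, moyal_C_C, moyal_assoc_C]

end Moyal

/-- The Moyal product makes `R[h]` into an associative unital `k[h]`-algebra:
it is associative, `k[h]`-bilinear (where `k[h]` sits inside `R[h]` via
`Polynomial.map (algebraMap k R)`), and has `1` as a two-sided unit. -/
theorem moyal_assoc_bilinear_unital (k : Type) [Field k] [CharZero k] (n : ℕ) :
    (∀ F G P : Polynomial (MoyalR k n), moyal (moyal F G) P = moyal F (moyal G P)) ∧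
    (∀ F G P : Polynomial (MoyalR k n), moyal (F + G) P = moyal F P + moyal G P) ∧
    (∀ F G P : Polynomial (MoyalR k n), moyal F (G + P) = moyal F G + moyal F P) ∧
    (∀ (a : Polynomial k) (F G : Polynomial (MoyalR k n)),
      moyal (a.map (algebraMap k (MoyalR k n)) * F) G
        = a.map (algebraMap k (MoyalR k n)) * moyal F G) ∧
    (∀ (a : Polynomial k) (F G : Polynomial (MoyalR k n)),
      moyal F (a.map (algebraMap k (MoyalR k n)) * G)
        = a.map (algebraMap k (MoyalR k n)) * moyal F G) ∧
    (∀ F : Polynomial (MoyalR k n), moyal 1 F = F ∧ moyal F 1 = F) := by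
  exact ⟨Moyal.moyal_assoc, Moyal.moyal_add_left, Moyal.moyal_add_right, Moyal.moyal_map_mul_left,
    Moyal.moyal_map_mul_right, fun F => ⟨Moyal.moyal_one_left F, Moyal.moyal_one_right F⟩⟩
end
end

section
/- The Moyal product quantizes the canonical Poisson bracket: for all f, g ∈ R, the element f *_h g − g *_h f − h·{f,g} of R[h] is divisible by h², where {f,g} = Σ_{i=1}^n (∂f/∂x_i · ∂g/∂y_i − ∂f/∂y_i · ∂g/∂x_i). -/
open scoped TensorProduct

noncomputable section

/-- The canonical Poisson bracket
`{f,g} = Σ_i (∂f/∂x_i · ∂g/∂y_i − ∂f/∂y_i · ∂g/∂x_i)` on `R`. -/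
def poissonBracket {k : Type} [Field k] {n : ℕ} (f g : MoyalR k n) : MoyalR k n :=
  ∑ i : Fin n,
    (MvPolynomial.pderiv (Sum.inl i) f * MvPolynomial.pderiv (Sum.inr i) g
      - MvPolynomial.pderiv (Sum.inr i) f * MvPolynomial.pderiv (Sum.inl i) g)

theorem poissonBracket_swap {k : Type} [Field k] {n : ℕ} (f g : MoyalR k n) :
    poissonBracket g f = -poissonBracket f g := by
  simp only [poissonBracket, ← Finset.sum_neg_distrib]
  exact Finset.sum_congr rfl fun i _ => by ring

theorem mul'_moyalPi_tmul {k : Type} [Field k] {n : ℕ} (f g : MoyalR k n) :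
    LinearMap.mul' k (MoyalR k n) (moyalPi k n (f ⊗ₜ[k] g)) = poissonBracket f g := by
  simp [moyalPi, poissonBracket, LinearMap.sum_apply, map_sum]

theorem poissonBracket_eq_zero_of_totalDegree_eq_zero {k : Type} [Field k] {n : ℕ}
    {f : MoyalR k n} (hf : f.totalDegree = 0) (g : MoyalR k n) : poissonBracket f g = 0 := by
  rw [MvPolynomial.totalDegree_eq_zero_iff_eq_C.mp hf]
  simp [poissonBracket]

theorem coeff_zero_moyalAux {k : Type} [Field k] {n : ℕ} (f g : MoyalR k n) :
    (moyalAux f g).coeff 0 = f * g := by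
  simp [moyalAux, Polynomial.finsetSum_coeff]

theorem coeff_one_moyalAux {k : Type} [Field k] {n : ℕ} (f g : MoyalR k n) :
    (moyalAux f g).coeff 1 = (2⁻¹ : k) • poissonBracket f g := by
  simp only [moyalAux, Polynomial.finsetSum_coeff, Polynomial.coeff_C_mul_X_pow,
    Finset.sum_ite_eq, Finset.mem_range]
  split_ifs with h
  · simp [mul'_moyalPi_tmul]
  · rw [poissonBracket_eq_zero_of_totalDegree_eq_zero (by omega), smul_zero]

/-- The Moyal product quantizes the canonical Poisson bracket:
`f *_h g − g *_h f − h·{f,g}` is divisible by `h²`. -/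
theorem moyal_quantizes_poisson (k : Type) [Field k] [CharZero k] (n : ℕ)
    (f g : MoyalR k n) :
    Polynomial.X ^ 2 ∣
      (moyalAux f g - moyalAux g f - Polynomial.X * Polynomial.C (poissonBracket f g)) := by
  rw [Polynomial.X_pow_dvd_iff]
  intro d hd
  interval_cases d
  · rw [Polynomial.coeff_sub, Polynomial.coeff_sub, coeff_zero_moyalAux, coeff_zero_moyalAux,
      mul_comm g f, sub_self, Polynomial.mul_coeff_zero, Polynomial.coeff_X_zero, zero_mul,
      sub_zero]
  · have h : (2⁻¹ : k) • poissonBracket f g + (2⁻¹ : k) • poissonBracket f g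
        = poissonBracket f g := by
      rw [← add_smul, ← two_mul, mul_inv_cancel₀ two_ne_zero, one_smul]
    rw [Polynomial.coeff_sub, Polynomial.coeff_sub, coeff_one_moyalAux, coeff_one_moyalAux,
      poissonBracket_swap f g, smul_neg, sub_neg_eq_add, h, Polynomial.coeff_X_mul,
      Polynomial.coeff_C_zero, sub_self]
end
end

section
/- Poincaré–Birkhoff–Witt theorem for the Weyl algebra: the symmetrization map φ_W : R[h] → A_h is a bijective k[h]-linear map. -/
noncomputable section

/-- The defining relations of the Weyl algebra `A_h` over `k[h]`:
`X_iX_j = X_jX_i`, `Y_iY_j = Y_jY_i`, `X_iY_j = Y_jX_i + h·δ_ij`. -/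
inductive weylRel (k : Type) [Field k] (n : ℕ) :
    FreeAlgebra (Polynomial k) (Fin n ⊕ Fin n) →
      FreeAlgebra (Polynomial k) (Fin n ⊕ Fin n) → Prop
  | xx (i j : Fin n) : weylRel k n
      (FreeAlgebra.ι (Polynomial k) (Sum.inl i) * FreeAlgebra.ι (Polynomial k) (Sum.inl j))
      (FreeAlgebra.ι (Polynomial k) (Sum.inl j) * FreeAlgebra.ι (Polynomial k) (Sum.inl i))
  | yy (i j : Fin n) : weylRel k n
      (FreeAlgebra.ι (Polynomial k) (Sum.inr i) * FreeAlgebra.ι (Polynomial k) (Sum.inr j))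
      (FreeAlgebra.ι (Polynomial k) (Sum.inr j) * FreeAlgebra.ι (Polynomial k) (Sum.inr i))
  | xy (i j : Fin n) : weylRel k n
      (FreeAlgebra.ι (Polynomial k) (Sum.inl i) * FreeAlgebra.ι (Polynomial k) (Sum.inr j))
      (FreeAlgebra.ι (Polynomial k) (Sum.inr j) * FreeAlgebra.ι (Polynomial k) (Sum.inl i)
        + if i = j then algebraMap (Polynomial k) _ Polynomial.X else 0)

/-- The Weyl algebra `A_h`, as a quotient of the free `k[h]`-algebra on the `2n`
generators by the Weyl relations. -/
abbrev WeylAlg (k : Type) [Field k] (n : ℕ) : Type := RingQuot (weylRel k n)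

/-- The generator `Z_v` of the Weyl algebra corresponding to the variable `z_v`. -/
def weylGen (k : Type) [Field k] (n : ℕ) (v : Fin n ⊕ Fin n) : WeylAlg k n :=
  RingQuot.mkAlgHom (Polynomial k) (weylRel k n) (FreeAlgebra.ι (Polynomial k) v)

/-- The symmetrization `(1/m!) Σ_{σ ∈ S_m} Z_{i_σ(1)} ⋯ Z_{i_σ(m)}` of the word of
generators determined by a monomial exponent `e`. -/
def symWord (k : Type) [Field k] (n : ℕ) (e : (Fin n ⊕ Fin n) →₀ ℕ) : WeylAlg k n :=
  let l := (Finsupp.toMultiset e).toList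
  algebraMap (Polynomial k) (WeylAlg k n) (Polynomial.C ((l.length.factorial : k)⁻¹)) *
    ∑ σ : Equiv.Perm (Fin l.length),
      (List.ofFn fun i => weylGen k n (l.get (σ i))).prod

/-- The symmetrization map `φ_W : R[h] → A_h`: the `k[h]`-linear map sending each
commutative monomial to the average of all its noncommutative orderings in `A_h`. -/
def phiW (k : Type) [Field k] (n : ℕ) (F : Polynomial (MoyalR k n)) : WeylAlg k n :=
  ∑ i ∈ F.support,
    algebraMap (Polynomial k) (WeylAlg k n) (Polynomial.X ^ i) *
      ∑ e ∈ (F.coeff i).support,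
        algebraMap (Polynomial k) (WeylAlg k n)
            (Polynomial.C (MvPolynomial.coeff e (F.coeff i))) * symWord k n e

theorem derivation_finset_prod {K P ι : Type*} [CommRing K] [CommRing P] [Algebra K P]
    [DecidableEq ι] (D : Derivation K P P) (g : ι → P) (s : Finset ι) :
    D (∏ i ∈ s, g i) = ∑ i ∈ s, (∏ j ∈ s.erase i, g j) * D (g i) := by
  induction s using Finset.induction_on with
  | empty => simp
  | insert a s ha ih =>
    rw [Finset.prod_insert ha, Derivation.leibniz, ih, Finset.sum_insert ha,
      Finset.erase_insert ha, smul_eq_mul, smul_eq_mul, Finset.mul_sum, add_comm]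
    congr 1
    refine Finset.sum_congr rfl fun i hi => ?_
    have hia : a ≠ i := fun h => ha (h ▸ hi)
    rw [Finset.erase_insert_of_ne hia,
      Finset.prod_insert (fun h => ha (Finset.mem_of_mem_erase h)), mul_assoc]

/-- For derivations whose values `D v (z w)` are alternating in `v, w`, the first order terms in
the symmetrized product cancel. -/
theorem sum_derivation_prod_erase_eq_zero {K P ι τ : Type*} [CommRing K] [CommRing P]
    [Algebra K P] [Fintype ι] [DecidableEq ι] (D : τ → Derivation K P P) (z : τ → P)
    (hD : ∀ v w, D v (z w) + D w (z v) = 0) (f : ι → τ) :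
    ∑ p, D (f p) (∏ i ∈ Finset.univ.erase p, z (f i)) = 0 := by
  simp_rw [derivation_finset_prod]
  rw [Finset.sum_sigma']
  refine Finset.sum_involution (fun a _ => ⟨a.2, a.1⟩) ?_ ?_ ?_ ?_
  · rintro ⟨p, q⟩ -
    dsimp only
    rw [Finset.erase_right_comm, ← mul_add, hD, mul_zero]
  · rintro ⟨p, q⟩ h - heq
    have hqp : q = p := congrArg Sigma.fst heq
    simp [hqp] at h
  · rintro ⟨p, q⟩ h
    simp only [Finset.mem_sigma, Finset.mem_univ, Finset.mem_erase, true_and, and_true] at h ⊢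
    exact h.symm
  · rintro ⟨p, q⟩ -
    rfl

/-- Symmetrized products of the operators `z v + D v` send `1` to the commutative product. -/
theorem sum_perm_prod_mulLeft_add_derivation_apply_one {K P τ : Type*} [CommRing K] [CommRing P]
    [Algebra K P] (D : τ → Derivation K P P) (z : τ → P)
    (hD : ∀ v w, D v (z w) + D w (z v) = 0) :
    ∀ (m : ℕ) (f : Fin m → τ),
      ∑ σ : Equiv.Perm (Fin m), (List.ofFn fun i =>
        (LinearMap.mulLeft K (z (f (σ i))) + (D (f (σ i)) : P →ₗ[K] P) : Module.End K P)).prod 1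
        = (m.factorial : P) * ∏ i, z (f i) := by
  intro m
  induction m with
  | zero => intro f; simp
  | succ m ih =>
    intro f
    have hprod (p : Fin (m + 1)) : ∏ i : Fin m, z (f (Equiv.swap 0 p i.succ))
        = ∏ i ∈ Finset.univ.erase p, z (f i) := by
      refine Finset.prod_bij (fun i _ => Equiv.swap 0 p i.succ) ?_ ?_ ?_ ?_
      · intro i _
        simp [Equiv.swap_apply_eq_iff]
      · intro i _ j _ h
        simpa using h
      · intro j hj
        have hj0 : Equiv.swap 0 p j ≠ 0 := by
          have := Finset.ne_of_mem_erase hj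
          simpa [Equiv.swap_apply_eq_iff] using this
        obtain ⟨i, hi⟩ := Fin.exists_succ_eq.mpr hj0
        exact ⟨i, Finset.mem_univ _, by rw [hi, Equiv.swap_apply_self]⟩
      · intro i _
        rfl
    rw [← Equiv.sum_comp Equiv.Perm.decomposeFin.symm, Fintype.sum_prod_type]
    have hstep (p : Fin (m + 1)) : ∑ e : Equiv.Perm (Fin m), (List.ofFn fun i =>
        (LinearMap.mulLeft K (z (f (Equiv.Perm.decomposeFin.symm (p, e) i)))
          + (D (f (Equiv.Perm.decomposeFin.symm (p, e) i)) : P →ₗ[K] P) :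
            Module.End K P)).prod 1
        = (m.factorial : P) * ∏ i, z (f i)
          + (m.factorial : P) * D (f p) (∏ i ∈ Finset.univ.erase p, z (f i)) := by
      simp only [List.ofFn_succ, List.prod_cons, Equiv.Perm.decomposeFin_symm_apply_zero,
        Equiv.Perm.decomposeFin_symm_apply_succ, Module.End.mul_apply]
      rw [← map_sum, ih fun i => f (Equiv.swap 0 p i.succ), hprod, ← nsmul_eq_mul, map_nsmul,
        LinearMap.add_apply, LinearMap.mulLeft_apply,
        Finset.mul_prod_erase _ (fun i => z (f i)) (Finset.mem_univ p), nsmul_eq_mul, mul_add]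
      rfl
    simp_rw [hstep]
    rw [Finset.sum_add_distrib, ← Finset.mul_sum _ _ (m.factorial : P),
      ← Finset.mul_sum _ _ (m.factorial : P), sum_derivation_prod_erase_eq_zero D z hD f]
    simp [Nat.factorial_succ, mul_assoc, mul_left_comm]

/-- The coefficients `±h/2` of the Moyal bracket. -/
def moyalCoeff (k : Type) [Field k] (n : ℕ) : Fin n ⊕ Fin n → Fin n ⊕ Fin n → Polynomial k
  | Sum.inl i, Sum.inr j => if i = j then Polynomial.C 2⁻¹ * Polynomial.X else 0
  | Sum.inr i, Sum.inl j => if i = j then -(Polynomial.C 2⁻¹ * Polynomial.X) else 0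
  | _, _ => 0

theorem moyalCoeff_add_swap (k : Type) [Field k] (n : ℕ) (v w : Fin n ⊕ Fin n) :
    moyalCoeff k n v w + moyalCoeff k n w v = 0 := by
  rcases v with i | i <;> rcases w with j | j <;>
    simp only [moyalCoeff, add_zero, eq_comm (a := j)] <;> split_ifs <;> simp

/-- The Hamiltonian derivation attached to a variable, scaled by `h/2`. -/
def moyalDer (k : Type) [Field k] (n : ℕ) (v : Fin n ⊕ Fin n) :
    Derivation (Polynomial k) (MvPolynomial (Fin n ⊕ Fin n) (Polynomial k))
      (MvPolynomial (Fin n ⊕ Fin n) (Polynomial k)) :=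
  MvPolynomial.mkDerivation _ fun w => MvPolynomial.C (moyalCoeff k n v w)

/-- Left Moyal multiplication by a variable. -/
def moyalOp (k : Type) [Field k] (n : ℕ) (v : Fin n ⊕ Fin n) :
    Module.End (Polynomial k) (MvPolynomial (Fin n ⊕ Fin n) (Polynomial k)) :=
  LinearMap.mulLeft (Polynomial k) (MvPolynomial.X v) + (moyalDer k n v : _ →ₗ[Polynomial k] _)

theorem moyalDer_X (k : Type) [Field k] (n : ℕ) (v w : Fin n ⊕ Fin n) :
    moyalDer k n v (MvPolynomial.X w) = MvPolynomial.C (moyalCoeff k n v w) :=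
  MvPolynomial.mkDerivation_X _ _ _

theorem moyalDer_comm (k : Type) [Field k] (n : ℕ) (v w : Fin n ⊕ Fin n)
    (p : MvPolynomial (Fin n ⊕ Fin n) (Polynomial k)) :
    moyalDer k n v (moyalDer k n w p) = moyalDer k n w (moyalDer k n v p) := by
  have h : ⁅moyalDer k n v, moyalDer k n w⁆ = 0 := by
    refine MvPolynomial.derivation_ext fun u => ?_
    rw [Derivation.commutator_apply, moyalDer_X, moyalDer_X, MvPolynomial.derivation_C,
      MvPolynomial.derivation_C]
    simp
  rw [← sub_eq_zero, ← Derivation.commutator_apply, h, Derivation.zero_apply]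

theorem moyalOp_mul (k : Type) [Field k] (n : ℕ) (v w : Fin n ⊕ Fin n) :
    moyalOp k n v * moyalOp k n w = moyalOp k n w * moyalOp k n v
      + algebraMap (Polynomial k) _ (moyalCoeff k n v w - moyalCoeff k n w v) := by
  refine LinearMap.ext fun p => ?_
  simp only [moyalOp, Module.End.mul_apply, LinearMap.add_apply, LinearMap.mulLeft_apply, map_add,
    Derivation.coeFn_coe, Derivation.leibniz, moyalDer_X, smul_eq_mul,
    Module.algebraMap_end_apply, MvPolynomial.smul_eq_C_mul]
  rw [moyalDer_comm k n v w, MvPolynomial.C_sub]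
  ring

/-- The Moyal representation of the Weyl algebra on commutative polynomials. -/
def moyalRep (k : Type) [Field k] [CharZero k] (n : ℕ) : WeylAlg k n →ₐ[Polynomial k]
    Module.End (Polynomial k) (MvPolynomial (Fin n ⊕ Fin n) (Polynomial k)) :=
  RingQuot.liftAlgHom (Polynomial k) ⟨FreeAlgebra.lift (Polynomial k) (moyalOp k n), by
    have h2 : (Polynomial.C (2⁻¹ : k)) * Polynomial.X + Polynomial.C 2⁻¹ * Polynomial.X
        = Polynomial.X := by
      rw [← add_mul, ← Polynomial.C_add, ← two_mul, mul_inv_cancel₀ two_ne_zero, Polynomial.C_1,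
        one_mul]
    intro a b hab
    cases hab with
    | xx i j => simpa [moyalCoeff] using moyalOp_mul k n (Sum.inl i) (Sum.inl j)
    | yy i j => simpa [moyalCoeff] using moyalOp_mul k n (Sum.inr i) (Sum.inr j)
    | xy i j =>
      rw [map_mul, map_add, map_mul, FreeAlgebra.lift_ι_apply, FreeAlgebra.lift_ι_apply,
        moyalOp_mul]
      by_cases h : i = j
      · simp only [moyalCoeff, h, if_true, sub_neg_eq_add, h2, AlgHom.commutes]
      · simp [moyalCoeff, h, Ne.symm h]⟩

theorem moyalRep_weylGen (k : Type) [Field k] [CharZero k] (n : ℕ) (v : Fin n ⊕ Fin n) :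
    moyalRep k n (weylGen k n v) = moyalOp k n v := by
  rw [moyalRep, weylGen, RingQuot.liftAlgHom_mkAlgHom_apply, FreeAlgebra.lift_ι_apply]

theorem C_inv_factorial_mul (k : Type) [Field k] [CharZero k] (m : ℕ) :
    Polynomial.C ((m.factorial : k)⁻¹) * (m.factorial : Polynomial k) = 1 := by
  rw [← Polynomial.C_eq_natCast, ← Polynomial.C_mul,
    inv_mul_cancel₀ (Nat.cast_ne_zero.mpr (Nat.factorial_ne_zero _)), Polynomial.C_1]

theorem moyalRep_symWord_one (k : Type) [Field k] [CharZero k] (n : ℕ)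
    (e : (Fin n ⊕ Fin n) →₀ ℕ) :
    moyalRep k n (symWord k n e) 1 = MvPolynomial.monomial e 1 := by
  set l := (Finsupp.toMultiset e).toList with hl
  have hm : (∏ i, (MvPolynomial.X (l.get i) : MvPolynomial (Fin n ⊕ Fin n) (Polynomial k)))
      = MvPolynomial.monomial e 1 := by
    rw [← List.prod_ofFn, ← Function.comp_def, ← List.map_ofFn, List.ofFn_get,
      ← Multiset.prod_coe, ← Multiset.map_coe, hl, Multiset.coe_toList,
      Finsupp.toMultiset_map, Finsupp.prod_toMultiset,
      Finsupp.prod_mapDomain_index (fun _ => pow_zero _) (fun _ _ _ => pow_add _ _ _),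
      MvPolynomial.monomial_eq, MvPolynomial.C_1, one_mul]
  have key := sum_perm_prod_mulLeft_add_derivation_apply_one (moyalDer k n) MvPolynomial.X
    (fun v w => by
      rw [moyalDer_X, moyalDer_X, ← MvPolynomial.C_add, moyalCoeff_add_swap, MvPolynomial.C_0])
    l.length l.get
  have hw : symWord k n e = algebraMap (Polynomial k) (WeylAlg k n)
      (Polynomial.C ((l.length.factorial : k)⁻¹)) *
      ∑ σ : Equiv.Perm (Fin l.length), (List.ofFn fun i => weylGen k n (l.get (σ i))).prod := rfl
  rw [hw, map_mul, AlgHom.commutes, map_sum, Module.End.mul_apply, Module.algebraMap_end_apply,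
    LinearMap.sum_apply]
  simp_rw [map_list_prod, List.map_ofFn, Function.comp_def, moyalRep_weylGen]
  refine (congrArg _ (key.trans (congrArg _ hm))).trans ?_
  rw [MvPolynomial.smul_eq_C_mul, ← mul_assoc, ← map_natCast MvPolynomial.C, ← MvPolynomial.C_mul,
    C_inv_factorial_mul, MvPolynomial.C_1, one_mul]

theorem phiW_add (k : Type) [Field k] (n : ℕ) (F G : Polynomial (MoyalR k n)) :
    phiW k n (F + G) = phiW k n F + phiW k n G := by
  have hinner (p q : MoyalR k n) :
      (AddMonoidAlgebra.coeff (p + q)).sum (fun e c =>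
          algebraMap (Polynomial k) (WeylAlg k n) (Polynomial.C c)
        * symWord k n e)
      = (AddMonoidAlgebra.coeff p).sum (fun e c =>
          algebraMap (Polynomial k) (WeylAlg k n) (Polynomial.C c)
        * symWord k n e)
      + (AddMonoidAlgebra.coeff q).sum (fun e c =>
          algebraMap (Polynomial k) (WeylAlg k n) (Polynomial.C c)
        * symWord k n e) :=
    Finsupp.sum_add_index' (by simp) (by simp [add_mul])
  refine Polynomial.sum_add_index F G (fun i p => algebraMap (Polynomial k) (WeylAlg k n)
    (Polynomial.X ^ i) * (AddMonoidAlgebra.coeff p).sum (fun e c =>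
      algebraMap (Polynomial k) (WeylAlg k n) (Polynomial.C c) * symWord k n e)) ?_ ?_
  · intro i
    simp
  · intro i p q
    rw [hinner, mul_add]

theorem phiW_monomial (k : Type) [Field k] (n i : ℕ) (e : (Fin n ⊕ Fin n) →₀ ℕ) (c : k) :
    phiW k n (Polynomial.monomial i (MvPolynomial.monomial e c))
      = algebraMap (Polynomial k) (WeylAlg k n) (Polynomial.monomial i c) * symWord k n e := by
  refine (Polynomial.sum_monomial_index _ (fun i (p : MoyalR k n) =>
    algebraMap (Polynomial k) (WeylAlg k n)
      (Polynomial.X ^ i) * (AddMonoidAlgebra.coeff p).sum (fun e c =>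
        algebraMap (Polynomial k) (WeylAlg k n) (Polynomial.C c) * symWord k n e)) (by simp)).trans ?_
  refine (congrArg _ (Finsupp.sum_single_index (by simp))).trans ?_
  rw [← mul_assoc, ← map_mul, mul_comm (Polynomial.X ^ i), Polynomial.C_mul_X_pow_eq_monomial]

theorem phiW_map_mul (k : Type) [Field k] (n : ℕ) (a : Polynomial k)
    (F : Polynomial (MoyalR k n)) :
    phiW k n (a.map (algebraMap k (MoyalR k n)) * F)
      = algebraMap (Polynomial k) (WeylAlg k n) a * phiW k n F := by
  induction F using Polynomial.induction_on' with
  | add F G hF hG => rw [mul_add, phiW_add, phiW_add, hF, hG, mul_add]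
  | monomial i p =>
    induction p using MvPolynomial.induction_on' with
    | add p q hp hq => rw [map_add, mul_add, phiW_add, phiW_add, hp, hq, mul_add]
    | monomial e c =>
      induction a using Polynomial.induction_on' with
      | add a b ha hb => rw [Polynomial.map_add, add_mul, phiW_add, ha, hb, map_add, add_mul]
      | monomial j d =>
        rw [Polynomial.map_monomial, Polynomial.monomial_mul_monomial,
          MvPolynomial.algebraMap_eq, MvPolynomial.C_mul_monomial, phiW_monomial, phiW_monomial,
          ← mul_assoc, ← map_mul, Polynomial.monomial_mul_monomial]

theorem coeff_coeff_moyalRep_phiW_one (k : Type) [Field k] [CharZero k] (n : ℕ)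
    (F : Polynomial (MoyalR k n)) (e : (Fin n ⊕ Fin n) →₀ ℕ) (i : ℕ) :
    (MvPolynomial.coeff e (moyalRep k n (phiW k n F) 1)).coeff i
      = MvPolynomial.coeff e (F.coeff i) := by
  induction F using Polynomial.induction_on' with
  | add F G hF hG =>
    rw [phiW_add, map_add, LinearMap.add_apply, MvPolynomial.coeff_add, Polynomial.coeff_add, hF,
      hG, Polynomial.coeff_add, MvPolynomial.coeff_add]
  | monomial j p =>
    induction p using MvPolynomial.induction_on' with
    | add p q hp hq =>
      rw [map_add, phiW_add, map_add, LinearMap.add_apply, MvPolynomial.coeff_add,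
        Polynomial.coeff_add, hp, hq, Polynomial.coeff_add, MvPolynomial.coeff_add]
    | monomial d c =>
      rw [phiW_monomial, map_mul, AlgHom.commutes, Module.End.mul_apply,
        Module.algebraMap_end_apply, moyalRep_symWord_one, MvPolynomial.coeff_smul,
        MvPolynomial.coeff_monomial, Polynomial.coeff_monomial]
      by_cases hd : d = e <;> by_cases hj : j = i <;>
        simp [hd, hj, MvPolynomial.coeff_monomial, Polynomial.coeff_monomial]

theorem phiW_injective (k : Type) [Field k] [CharZero k] (n : ℕ) :
    Function.Injective (phiW k n) := by
  intro F G h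
  ext i e
  rw [← coeff_coeff_moyalRep_phiW_one, h, coeff_coeff_moyalRep_phiW_one]

/-- The commutators of the generators are scalars. -/
theorem exists_weylGen_mul_eq (k : Type) [Field k] (n : ℕ) (v w : Fin n ⊕ Fin n) :
    ∃ c : Polynomial k, weylGen k n v * weylGen k n w
      = weylGen k n w * weylGen k n v + algebraMap (Polynomial k) (WeylAlg k n) c := by
  have hxy (i j : Fin n) : weylGen k n (Sum.inl i) * weylGen k n (Sum.inr j)
      = weylGen k n (Sum.inr j) * weylGen k n (Sum.inl i)
        + algebraMap (Polynomial k) (WeylAlg k n) (if i = j then Polynomial.X else 0) := by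
    have h := RingQuot.mkAlgHom_rel (Polynomial k) (weylRel.xy (k := k) i j)
    rw [map_mul, map_add, map_mul] at h
    refine h.trans (congrArg _ ?_)
    split_ifs
    · exact AlgHom.commutes _ _
    · simp
  rcases v with i | i <;> rcases w with j | j
  · refine ⟨0, ?_⟩
    have h := RingQuot.mkAlgHom_rel (Polynomial k) (weylRel.xx (k := k) i j)
    rw [map_mul, map_mul] at h
    rw [map_zero, add_zero]
    exact h
  · exact ⟨_, hxy i j⟩
  · refine ⟨-(if j = i then Polynomial.X else 0), ?_⟩
    rw [hxy j i, add_assoc, ← map_add, add_neg_cancel, map_zero, add_zero]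
  · refine ⟨0, ?_⟩
    have h := RingQuot.mkAlgHom_rel (Polynomial k) (weylRel.yy (k := k) i j)
    rw [map_mul, map_mul] at h
    rw [map_zero, add_zero]
    exact h

/-- The span of the words of length less than `m` in the generators. -/
def weylFiltration (k : Type) [Field k] (n m : ℕ) : Submodule (Polynomial k) (WeylAlg k n) :=
  Submodule.span (Polynomial k)
    {a | ∃ l : List (Fin n ⊕ Fin n), l.length < m ∧ (l.map (weylGen k n)).prod = a}

theorem weylGen_mul_mem_weylFiltration (k : Type) [Field k] (n m : ℕ) (v : Fin n ⊕ Fin n)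
    {a : WeylAlg k n} (ha : a ∈ weylFiltration k n m) :
    weylGen k n v * a ∈ weylFiltration k n (m + 1) := by
  induction ha using Submodule.span_induction with
  | mem a h =>
    obtain ⟨l, hl, rfl⟩ := h
    exact Submodule.subset_span ⟨v :: l, by simpa using hl, by simp⟩
  | zero => simp
  | add a b _ _ ha hb => rw [mul_add]; exact add_mem ha hb
  | smul r a _ ha => rw [mul_smul_comm]; exact Submodule.smul_mem _ _ ha

/-- Reordering a word changes it by a combination of shorter words. -/
theorem exists_mem_weylFiltration_prod_eq_of_perm (k : Type) [Field k] (n : ℕ)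
    {l l' : List (Fin n ⊕ Fin n)} (h : l.Perm l') :
    ∃ r ∈ weylFiltration k n l.length,
      (l.map (weylGen k n)).prod = (l'.map (weylGen k n)).prod + r := by
  induction h with
  | nil => exact ⟨0, zero_mem _, (add_zero _).symm⟩
  | cons v _ ih =>
    obtain ⟨r, hr, h⟩ := ih
    exact ⟨weylGen k n v * r, weylGen_mul_mem_weylFiltration k n _ v hr, by
      rw [List.map_cons, List.prod_cons, h, mul_add, List.map_cons, List.prod_cons]⟩
  | swap v w l =>
    obtain ⟨c, hc⟩ := exists_weylGen_mul_eq k n w v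
    refine ⟨c • (l.map (weylGen k n)).prod,
      Submodule.smul_mem _ _ (Submodule.subset_span ⟨l, ?_, rfl⟩), ?_⟩
    · simp only [List.length_cons]
      omega
    · simp only [List.map_cons, List.prod_cons, ← mul_assoc]
      rw [hc, add_mul, ← Algebra.smul_def]
  | trans h₁ _ ih₁ ih₂ =>
    obtain ⟨r, hr, h⟩ := ih₁
    obtain ⟨r', hr', h'⟩ := ih₂
    rw [← h₁.length_eq] at hr'
    exact ⟨r' + r, add_mem hr' hr, by rw [h, h', add_assoc]⟩

/-- A word agrees with its symmetrization up to shorter words. -/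
theorem exists_mem_weylFiltration_prod_eq_symWord (k : Type) [Field k] [CharZero k] (n : ℕ)
    (l : List (Fin n ⊕ Fin n)) :
    ∃ r ∈ weylFiltration k n l.length, (l.map (weylGen k n)).prod
      = symWord k n (Multiset.toFinsupp (l : Multiset _)) + r := by
  set e := Multiset.toFinsupp (l : Multiset (Fin n ⊕ Fin n)) with he
  set l' := (Finsupp.toMultiset e).toList with hl'
  have hperm : l.Perm l' := by
    rw [← Multiset.coe_eq_coe, hl', Multiset.coe_toList, he, Multiset.toFinsupp_toMultiset]
  have hσ (σ : Equiv.Perm (Fin l'.length)) : ∃ r ∈ weylFiltration k n l.length,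
      (l.map (weylGen k n)).prod = (List.ofFn fun i => weylGen k n (l'.get (σ i))).prod + r := by
    have h := σ.ofFn_comp_perm l'.get
    rw [List.ofFn_get] at h
    have h' := exists_mem_weylFiltration_prod_eq_of_perm k n (hperm.trans h.symm)
    rw [List.map_ofFn] at h'
    exact h'
  choose r hr h using hσ
  have hw : symWord k n e = Polynomial.C ((l'.length.factorial : k)⁻¹) •
      ∑ σ : Equiv.Perm (Fin l'.length), (List.ofFn fun i => weylGen k n (l'.get (σ i))).prod :=
    (Algebra.smul_def _ _).symm
  refine ⟨Polynomial.C ((l'.length.factorial : k)⁻¹) • ∑ σ, r σ,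
    Submodule.smul_mem _ _ (Submodule.sum_mem _ fun σ _ => hr σ), ?_⟩
  rw [hw, ← smul_add, ← Finset.sum_add_distrib, ← Finset.sum_congr rfl fun σ _ => h σ,
    Finset.sum_const, Finset.card_univ, Fintype.card_perm, Fintype.card_fin,
    ← Nat.cast_smul_eq_nsmul (Polynomial k), smul_smul, C_inv_factorial_mul, one_smul]

/-- The range of the symmetrization map, as a `k[h]`-submodule. -/
def phiWRange (k : Type) [Field k] (n : ℕ) : Submodule (Polynomial k) (WeylAlg k n) where
  carrier := Set.range (phiW k n)
  add_mem' := by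
    rintro _ _ ⟨F, rfl⟩ ⟨G, rfl⟩
    exact ⟨F + G, phiW_add k n F G⟩
  zero_mem' := ⟨0, by simp [phiW]⟩
  smul_mem' := by
    rintro a _ ⟨F, rfl⟩
    exact ⟨_, (phiW_map_mul k n a F).trans (Algebra.smul_def _ _).symm⟩

theorem weylFiltration_le_phiWRange (k : Type) [Field k] [CharZero k] (n m : ℕ) :
    weylFiltration k n m ≤ phiWRange k n := by
  induction m with
  | zero => exact Submodule.span_le.mpr fun a ⟨l, hl, _⟩ => absurd hl (Nat.not_lt_zero _)
  | succ m ih =>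
    refine Submodule.span_le.mpr ?_
    rintro _ ⟨l, hl, rfl⟩
    have hle : weylFiltration k n l.length ≤ weylFiltration k n m :=
      Submodule.span_mono fun a ⟨l', hl', ha⟩ => ⟨l', by omega, ha⟩
    obtain ⟨r, hr, h⟩ := exists_mem_weylFiltration_prod_eq_symWord k n l
    have hs (e : (Fin n ⊕ Fin n) →₀ ℕ) : symWord k n e ∈ phiWRange k n :=
      ⟨Polynomial.monomial 0 (MvPolynomial.monomial e 1), (phiW_monomial k n 0 e 1).trans (by
        rw [Polynomial.monomial_zero_one, map_one, one_mul])⟩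
    rw [h]
    exact add_mem (hs _) (ih (hle hr))

theorem phiW_surjective (k : Type) [Field k] [CharZero k] (n : ℕ) :
    Function.Surjective (phiW k n) := by
  intro a
  have hadj : Algebra.adjoin (Polynomial k) (Set.range (weylGen k n)) = ⊤ := by
    have hg : Set.range (weylGen k n) = RingQuot.mkAlgHom (Polynomial k) (weylRel k n) ''
        Set.range (FreeAlgebra.ι (Polynomial k)) := by
      rw [← Set.range_comp]
      rfl
    rw [hg, ← AlgHom.map_adjoin, FreeAlgebra.adjoin_range_ι, Algebra.map_top,
      AlgHom.range_eq_top]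
    exact RingQuot.mkAlgHom_surjective (Polynomial k) (weylRel k n)
  have ha : a ∈ Subalgebra.toSubmodule
      (Algebra.adjoin (Polynomial k) (Set.range (weylGen k n))) := by
    rw [hadj]
    exact Submodule.mem_top
  rw [Algebra.adjoin_eq_span] at ha
  suffices h : Submodule.span (Polynomial k)
      (Submonoid.closure (Set.range (weylGen k n)) : Set (WeylAlg k n)) ≤ phiWRange k n from h ha
  refine Submodule.span_le.mpr fun b hb => ?_
  obtain ⟨l, hl, rfl⟩ := Submonoid.exists_list_of_mem_closure hb
  obtain ⟨l', rfl⟩ : ∃ l' : List (Fin n ⊕ Fin n), l'.map (weylGen k n) = l := by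
    rw [← Set.mem_range, Set.range_list_map]
    exact hl
  exact weylFiltration_le_phiWRange k n (l'.length + 1)
    (Submodule.subset_span ⟨l', Nat.lt_succ_self _, rfl⟩)

/-- Poincaré–Birkhoff–Witt for the Weyl algebra: the symmetrization map
`φ_W : R[h] → A_h` is a bijective `k[h]`-linear map (where `k[h]` sits inside
`R[h]` via `Polynomial.map (algebraMap k R)`). -/
theorem phiW_bijective_linear (k : Type) [Field k] [CharZero k] (n : ℕ) :
    Function.Bijective (phiW k n) ∧
    (∀ F G : Polynomial (MoyalR k n), phiW k n (F + G) = phiW k n F + phiW k n G) ∧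
    (∀ (a : Polynomial k) (F : Polynomial (MoyalR k n)),
      phiW k n (a.map (algebraMap k (MoyalR k n)) * F)
        = algebraMap (Polynomial k) (WeylAlg k n) a * phiW k n F) := by
  exact ⟨⟨phiW_injective k n, phiW_surjective k n⟩, phiW_add k n, phiW_map_mul k n⟩
end
end
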